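/- arXiv:2111.14601 — 4 statements merged into one kernel-verified Lean document; each statement's English description precedes it below -/
import Mathlib

section
/- Let c₀ ≥ 0 and define F(t,x) = ∫₀^∞ (g(t, x−y) − g(t, x+y)) dy + 2 ∫₀^∞ e^{−c₀ w} g(t, w+x) dw for t > 0 and x ≥ 0. Then for every λ > 0 and x ≥ 0, ∫₀^∞ e^{−λt} F(t,x) dt = 1/λ − (e^{−x√λ}/λ) · (c₀/(c₀ + √λ)). -/
open MeasureTheory Real

/-- The Gaussian heat kernel `g(t,z) = exp(-z^2/(4t))/sqrt(4*pi*t)`. -/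
noncomputable def g (t z : ℝ) : ℝ := Real.exp (-z ^ 2 / (4 * t)) / Real.sqrt (4 * Real.pi * t)

/-- The survival probability of the elastic Brownian motion on `[0,∞)` with elastic
coefficient `c₀`. -/
noncomputable def F (c₀ t x : ℝ) : ℝ :=
  (∫ y in Set.Ioi (0 : ℝ), (g t (x - y) - g t (x + y)))
    + 2 * ∫ w in Set.Ioi (0 : ℝ), Real.exp (-c₀ * w) * g t (w + x)


lemma ftc0 {f f' : ℝ → ℝ} {l m : ℝ} (hd : ∀ t ∈ Set.Ioi (0:ℝ), HasDerivAt f (f' t) t)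
    (pos : ∀ t ∈ Set.Ioi (0:ℝ), 0 ≤ f' t)
    (h0 : Filter.Tendsto f (nhdsWithin 0 (Set.Ioi 0)) (nhds m))
    (h1 : Filter.Tendsto f Filter.atTop (nhds l)) :
    IntegrableOn f' (Set.Ioi 0) ∧ ∫ t in Set.Ioi (0:ℝ), f' t = l - m := by
  have hc : ContinuousWithinAt (Function.update f 0 m) (Set.Ici 0) 0 := by
    rw [continuousWithinAt_update_same]
    simpa using h0
  have hd' : ∀ t ∈ Set.Ioi (0:ℝ), HasDerivAt (Function.update f 0 m) (f' t) t := by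
    intro t ht
    refine (hd t ht).congr_of_eventuallyEq ?_
    filter_upwards [Ioi_mem_nhds ht] with s hs
    exact Function.update_of_ne (ne_of_gt hs) _ _
  have h1' : Filter.Tendsto (Function.update f 0 m) Filter.atTop (nhds l) := by
    refine h1.congr' ?_
    filter_upwards [Filter.eventually_gt_atTop 0] with s hs
    exact (Function.update_of_ne (ne_of_gt hs) _ _).symm
  refine ⟨integrableOn_Ioi_deriv_of_nonneg hc hd' pos h1', ?_⟩
  rw [integral_Ioi_of_hasDerivAt_of_nonneg hc hd' pos h1']
  simp

noncomputable def Phi (u : ℝ) : ℝ := ∫ v in (0:ℝ)..u, Real.exp (-1 * v ^ 2)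

lemma Phi_deriv (u : ℝ) : HasDerivAt Phi (Real.exp (-u ^ 2)) u := by
  have hc : Continuous (fun v : ℝ => Real.exp (-1 * v ^ 2)) := by fun_prop
  have := hc.integral_hasStrictDerivAt 0 u
  have h2 := this.hasDerivAt
  rw [show Real.exp (-1 * u ^ 2) = Real.exp (-u ^ 2) by simp] at h2
  exact h2

lemma Phi_top : Filter.Tendsto Phi Filter.atTop (nhds (√π / 2)) := by
  have := intervalIntegral_tendsto_integral_Ioi (0:ℝ)
    (integrable_exp_neg_mul_sq (b := 1) one_pos).integrableOn Filter.tendsto_id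
  rw [integral_gaussian_Ioi] at this
  rw [div_one] at this
  exact this

lemma Phi_neg (u : ℝ) : Phi (-u) = - Phi u := by
  unfold Phi
  rw [intervalIntegral.integral_symm]
  have := intervalIntegral.integral_comp_neg (a := 0) (b := u)
    (fun v : ℝ => Real.exp (-1 * v ^ 2))
  simp only [neg_zero, neg_sq] at this
  rw [this]

lemma Phi_bot : Filter.Tendsto Phi Filter.atBot (nhds (-(√π / 2))) := by
  have := (Phi_top.comp Filter.tendsto_neg_atBot_atTop).neg
  refine this.congr fun u => ?_
  simp [Phi_neg]

lemma key (a b : ℝ) (ha : 0 < a) (hb : 0 ≤ b) :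
    IntegrableOn (fun t => Real.exp (-(a ^ 2 * t) - b ^ 2 / t) * (a / √t)) (Set.Ioi 0) ∧
    ∫ t in Set.Ioi (0:ℝ), Real.exp (-(a ^ 2 * t) - b ^ 2 / t) * (a / √t)
      = Real.exp (-(2 * a * b)) * √π := by
  set H : ℝ → ℝ := fun t => Real.exp (2 * a * b) * Phi (a * √t + b / √t)
    + Real.exp (-(2 * a * b)) * Phi (a * √t - b / √t) with hH
  have hd : ∀ t ∈ Set.Ioi (0:ℝ), HasDerivAt H
      (Real.exp (-(a ^ 2 * t) - b ^ 2 / t) * (a / √t)) t := by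
    intro t ht
    have ht0 : 0 < t := ht
    have hs : 0 < √t := Real.sqrt_pos.2 ht0
    have hsq : √t ^ 2 = t := Real.sq_sqrt ht0.le
    have d1 : HasDerivAt (fun t => √t) (1 / (2 * √t)) t := Real.hasDerivAt_sqrt ht0.ne'
    have d2 : HasDerivAt (fun t => b / √t) (-(b * (1 / (2 * √t))) / √t ^ 2) t := by
      have := (hasDerivAt_const t b).div d1 hs.ne'
      refine this.congr_deriv ?_
      simp
    have e1 := ((Phi_deriv _).comp t ((d1.const_mul a).add d2)).const_mul (Real.exp (2 * a * b))
    have e2 := ((Phi_deriv _).comp t ((d1.const_mul a).sub d2)).const_mul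
      (Real.exp (-(2 * a * b)))
    refine (e1.add e2).congr_deriv ?_
    have x1 : Real.exp (2 * a * b) * Real.exp (-(a * √t + b / √t) ^ 2)
        = Real.exp (-(a ^ 2 * t) - b ^ 2 / t) := by
      rw [← Real.exp_add]
      congr 1
      rw [← hsq]
      simp only [Real.sqrt_sq hs.le]
      field_simp
      ring
    have x2 : Real.exp (-(2 * a * b)) * Real.exp (-(a * √t - b / √t) ^ 2)
        = Real.exp (-(a ^ 2 * t) - b ^ 2 / t) := by
      rw [← Real.exp_add]
      congr 1
      rw [← hsq]
      simp only [Real.sqrt_sq hs.le]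
      field_simp
      ring
    simp only [Pi.add_apply, Pi.sub_apply]
    rw [← mul_assoc, ← mul_assoc, x1, x2]
    field_simp
    ring
  have sqtop : Filter.Tendsto (fun t : ℝ => √t) Filter.atTop Filter.atTop := Real.tendsto_sqrt_atTop
  have dtop : Filter.Tendsto (fun t : ℝ => b / √t) Filter.atTop (nhds 0) :=
    sqtop.const_div_atTop b
  have atop : Filter.Tendsto (fun t : ℝ => a * √t) Filter.atTop Filter.atTop :=
    sqtop.const_mul_atTop ha
  have h1 : Filter.Tendsto H Filter.atTop (nhds (Real.exp (2 * a * b) * (√π / 2)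
      + Real.exp (-(2 * a * b)) * (√π / 2))) := by
    refine Filter.Tendsto.add (Filter.Tendsto.const_mul _ ?_) (Filter.Tendsto.const_mul _ ?_)
    · exact Phi_top.comp (atop.atTop_add dtop)
    · refine Phi_top.comp ?_
      simp only [sub_eq_add_neg]
      exact atop.atTop_add dtop.neg
  have szero : Filter.Tendsto (fun t : ℝ => √t) (nhdsWithin 0 (Set.Ioi 0))
      (nhdsWithin 0 (Set.Ioi 0)) := by
    refine tendsto_nhdsWithin_iff.2 ⟨?_, ?_⟩
    · have := (Real.continuous_sqrt.tendsto 0).mono_left (nhdsWithin_le_nhds (s := Set.Ioi 0))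
      simpa using this
    · filter_upwards [self_mem_nhdsWithin] with t ht
      exact Real.sqrt_pos.2 ht
  have azero : Filter.Tendsto (fun t : ℝ => a * √t) (nhdsWithin 0 (Set.Ioi 0)) (nhds 0) := by
    simpa using (szero.mono_right nhdsWithin_le_nhds).const_mul a
  have pos : ∀ t ∈ Set.Ioi (0:ℝ), 0 ≤ Real.exp (-(a ^ 2 * t) - b ^ 2 / t) * (a / √t) := by
    intro t ht
    positivity
  rcases hb.eq_or_lt with hb0 | hb0
  · have h0 : Filter.Tendsto H (nhdsWithin 0 (Set.Ioi 0)) (nhds 0) := by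
      have c := ((Phi_deriv 0).continuousAt.tendsto).comp azero
      have p0 : Phi 0 = 0 := by simp [Phi]
      rw [p0] at c
      have := c.add c
      simpa [hH, ← hb0, Function.comp_def] using this
    obtain ⟨i, e⟩ := ftc0 hd pos h0 h1
    refine ⟨i, e.trans ?_⟩
    simp [← hb0]
  · have bz : Filter.Tendsto (fun t : ℝ => b / √t) (nhdsWithin 0 (Set.Ioi 0)) Filter.atTop := by
      simp only [div_eq_mul_inv]
      exact (tendsto_inv_nhdsGT_zero.comp szero).const_mul_atTop hb0
    have h0 : Filter.Tendsto H (nhdsWithin 0 (Set.Ioi 0)) (nhds (Real.exp (2 * a * b) * (√π / 2)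
      + Real.exp (-(2 * a * b)) * (-(√π / 2)))) := by
      refine Filter.Tendsto.add (Filter.Tendsto.const_mul _ ?_) (Filter.Tendsto.const_mul _ ?_)
      · exact Phi_top.comp (azero.add_atTop bz)
      · refine Phi_bot.comp ?_
        simp only [sub_eq_add_neg]
        exact azero.add_atBot (Filter.tendsto_neg_atTop_atBot.comp bz)
    obtain ⟨i, e⟩ := ftc0 hd pos h0 h1
    refine ⟨i, e.trans ?_⟩
    ring

lemma g_eq (s z t : ℝ) (hs : 0 < s) (ht : 0 < t) : Real.exp (-s ^ 2 * t) * g t z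
    = (1 / (2 * √π * s)) * (Real.exp (-(s ^ 2 * t) - (|z| / 2) ^ 2 / t) * (s / √t)) := by
  have hp : 0 < √π := Real.sqrt_pos.2 Real.pi_pos
  have hst : 0 < √t := Real.sqrt_pos.2 ht
  have h4 : √(4 * π * t) = 2 * √π * √t := by
    rw [Real.sqrt_mul (by positivity), Real.sqrt_mul (by positivity)]
    congr 2
    rw [show (4:ℝ) = 2 ^ 2 by norm_num]
    exact Real.sqrt_sq (by norm_num)
  have : Real.exp (-(s ^ 2 * t) - (|z| / 2) ^ 2 / t)
      = Real.exp (-s ^ 2 * t) * Real.exp (-z ^ 2 / (4 * t)) := by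
    rw [← Real.exp_add]
    congr 1
    rw [div_pow, sq_abs]
    field_simp
    ring
  rw [this, g, h4]
  field_simp

lemma g_lap (s z : ℝ) (hs : 0 < s) :
    IntegrableOn (fun t => Real.exp (-s ^ 2 * t) * g t z) (Set.Ioi 0) ∧
    ∫ t in Set.Ioi (0:ℝ), Real.exp (-s ^ 2 * t) * g t z = Real.exp (-s * |z|) / (2 * s) := by
  obtain ⟨i, e⟩ := key s (|z| / 2) hs (by positivity)
  have hp : 0 < √π := Real.sqrt_pos.2 Real.pi_pos
  constructor
  · refine IntegrableOn.congr_fun (i.const_mul (1 / (2 * √π * s))) ?_ measurableSet_Ioi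
    intro t ht
    exact (g_eq s z t hs ht).symm
  · rw [setIntegral_congr_fun measurableSet_Ioi (fun t ht => g_eq s z t hs ht),
      integral_const_mul, e]
    rw [show -(2 * s * (|z| / 2)) = -s * |z| by ring]
    field_simp

lemma g_nonneg (t z : ℝ) : 0 ≤ g t z := by
  unfold g
  positivity

lemma g_meas : Measurable (fun p : ℝ × ℝ => g p.1 p.2) := by
  unfold g
  fun_prop

lemma fub (s : ℝ) (hs : 0 < s) (φ h : ℝ → ℝ) (hφ : Measurable φ) (hh : Measurable h)
    (φ0 : ∀ y, 0 ≤ φ y)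
    (hi : IntegrableOn (fun y => φ y * Real.exp (-s * |h y|)) (Set.Ioi 0)) :
    IntegrableOn (fun t => Real.exp (-s ^ 2 * t) * ∫ y in Set.Ioi (0:ℝ), φ y * g t (h y))
      (Set.Ioi 0) ∧
    ∫ t in Set.Ioi (0:ℝ), Real.exp (-s ^ 2 * t) * ∫ y in Set.Ioi (0:ℝ), φ y * g t (h y)
      = (∫ y in Set.Ioi (0:ℝ), φ y * Real.exp (-s * |h y|)) / (2 * s) := by
  set K : ℝ → ℝ → ℝ := fun t y => φ y * (Real.exp (-s ^ 2 * t) * g t (h y)) with hK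
  have hKm : Measurable (Function.uncurry K) := by
    have : Measurable (fun p : ℝ × ℝ => g p.1 (h p.2)) :=
      g_meas.comp (measurable_fst.prodMk (hh.comp measurable_snd))
    simp only [hK, Function.uncurry_def]
    fun_prop
  have hK0 : ∀ t y, 0 ≤ K t y := fun t y =>
    mul_nonneg (φ0 y) (mul_nonneg (Real.exp_pos _).le (g_nonneg _ _))
  have hKe : ∀ y, ∫ t in Set.Ioi (0:ℝ), K t y = φ y * Real.exp (-s * |h y|) / (2 * s) := by
    intro y
    simp only [hK]
    rw [integral_const_mul, (g_lap s (h y) hs).2]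
    ring
  have hint : Integrable (Function.uncurry K)
      ((volume.restrict (Set.Ioi (0:ℝ))).prod (volume.restrict (Set.Ioi (0:ℝ)))) := by
    rw [integrable_prod_iff' hKm.aestronglyMeasurable]
    constructor
    · exact Filter.Eventually.of_forall fun y => (g_lap s (h y) hs).1.const_mul (φ y)
    · simp only [Function.uncurry_apply_pair, Real.norm_of_nonneg (hK0 _ _), hKe]
      exact hi.div_const _
  have hKy : ∀ t, Real.exp (-s ^ 2 * t) * ∫ y in Set.Ioi (0:ℝ), φ y * g t (h y)
      = ∫ y in Set.Ioi (0:ℝ), K t y := by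
    intro t
    rw [← integral_const_mul]
    congr 1
    ext y
    simp only [hK]
    ring
  simp only [hKy]
  refine ⟨hint.integral_prod_left, ?_⟩
  rw [integral_integral_swap hint]
  simp only [hKe]
  rw [integral_div]

lemma g_int (t : ℝ) (ht : 0 < t) : Integrable (g t) := by
  have := (integrable_exp_neg_mul_sq (b := 1 / (4 * t)) (by positivity)).div_const √(4 * π * t)
  refine this.congr (Filter.Eventually.of_forall fun z => ?_)
  simp only [g]
  congr 2
  ring

lemma abs_int (s x : ℝ) (hs : 0 < s) (hx : 0 ≤ x) :
    IntegrableOn (fun y => Real.exp (-s * |x - y|)) (Set.Ioi 0) ∧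
    ∫ y in Set.Ioi (0:ℝ), Real.exp (-s * |x - y|) = (2 - Real.exp (-s * x)) / s := by
  have e1 : Set.EqOn (fun y => Real.exp (s * x) * Real.exp (-s * y))
      (fun y => Real.exp (-s * |x - y|)) (Set.Ioi x) := by
    intro y hy
    have hy' : x < y := hy
    simp only
    rw [abs_of_neg (by linarith), ← Real.exp_add]
    congr 1
    ring
  have i1 : IntegrableOn (fun y => Real.exp (-s * |x - y|)) (Set.Ioi x) :=
    IntegrableOn.congr_fun
      ((integrableOn_exp_mul_Ioi (a := -s) (by linarith) x).const_mul _) e1 measurableSet_Ioi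
  have v1 : ∫ y in Set.Ioi x, Real.exp (-s * |x - y|) = 1 / s := by
    rw [← setIntegral_congr_fun measurableSet_Ioi e1, integral_const_mul,
      integral_exp_mul_Ioi (by linarith), neg_div_neg_eq, ← mul_div_assoc, ← Real.exp_add]
    rw [show s * x + -s * x = 0 by ring, Real.exp_zero]
  have i2 : IntervalIntegrable (fun y => Real.exp (-s * |x - y|)) volume 0 x :=
    Continuous.intervalIntegrable (by fun_prop) _ _
  have v2 : ∫ y in (0:ℝ)..x, Real.exp (-s * |x - y|) = (1 - Real.exp (-s * x)) / s := by
    have : ∫ y in (0:ℝ)..x, Real.exp (-s * |x - y|)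
        = ∫ y in (0:ℝ)..x, Real.exp (-s * (x - y)) := by
      refine intervalIntegral.integral_congr fun y hy => ?_
      rw [Set.uIcc_of_le hx] at hy
      rw [abs_of_nonneg (by linarith [hy.2])]
    rw [this, intervalIntegral.integral_eq_sub_of_hasDerivAt
      (f := fun y => Real.exp (-s * (x - y)) / s)]
    · simp
      ring
    · intro y _
      have := ((((hasDerivAt_id y).const_sub x).const_mul (-s)).exp).div_const s
      refine this.congr_deriv ?_
      simp only [id]
      field_simp
    · exact Continuous.intervalIntegrable (by fun_prop) _ _
  constructor
  · rw [← Set.Ioc_union_Ioi_eq_Ioi hx]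
    exact ((intervalIntegrable_iff_integrableOn_Ioc_of_le hx).1 i2).union i1
  · rw [← intervalIntegral.integral_interval_add_Ioi' i2 i1, v1, v2]
    ring

lemma exp_int (s c x : ℝ) (hs : 0 < s) (hc : 0 ≤ c) (hx : 0 ≤ x) :
    IntegrableOn (fun y => Real.exp (-c * y) * Real.exp (-s * |y + x|)) (Set.Ioi 0) ∧
    ∫ y in Set.Ioi (0:ℝ), Real.exp (-c * y) * Real.exp (-s * |y + x|)
      = Real.exp (-s * x) / (c + s) := by
  have e1 : Set.EqOn (fun y => Real.exp (-s * x) * Real.exp (-(c + s) * y))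
      (fun y => Real.exp (-c * y) * Real.exp (-s * |y + x|)) (Set.Ioi 0) := by
    intro y hy
    have hy' : 0 < y := hy
    simp only
    rw [abs_of_pos (by linarith), ← Real.exp_add, ← Real.exp_add]
    congr 1
    ring
  constructor
  · exact IntegrableOn.congr_fun
      ((integrableOn_exp_mul_Ioi (a := -(c + s)) (by linarith) 0).const_mul _) e1
      measurableSet_Ioi
  · rw [← setIntegral_congr_fun measurableSet_Ioi e1, integral_const_mul,
      integral_exp_mul_Ioi (by linarith), neg_div_neg_eq]
    simp
    ring

/-- the Laplace transform in time of the survival probability of the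
elastic Brownian motion:
`∫₀^∞ e^{-λt} F(t,x) dt = 1/λ - (e^{-x√λ}/λ)(c₀/(c₀+√λ))`. -/
theorem stmt13 (c₀ : ℝ) (hc : 0 ≤ c₀) (lam x : ℝ) (hlam : 0 < lam) (hx : 0 ≤ x) :
    ∫ t in Set.Ioi (0 : ℝ), Real.exp (-lam * t) * F c₀ t x
      = 1 / lam - Real.exp (-x * Real.sqrt lam) / lam * (c₀ / (c₀ + Real.sqrt lam)) := by
  obtain ⟨s, hs, rfl⟩ : ∃ s : ℝ, 0 < s ∧ lam = s ^ 2 :=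
    ⟨√lam, Real.sqrt_pos.2 hlam, (Real.sq_sqrt hlam.le).symm⟩
  rw [Real.sqrt_sq hs.le]
  have a1 := abs_int s x hs hx
  have a2 := exp_int s 0 x hs le_rfl hx
  have a3 := exp_int s c₀ x hs hc hx
  have f1 := fub s hs (fun _ => 1) (fun y => x - y) (by fun_prop) (by fun_prop)
    (fun _ => zero_le_one) (by simpa using a1.1)
  have f2 := fub s hs (fun y => Real.exp (-0 * y)) (fun y => y + x) (by fun_prop) (by fun_prop)
    (fun _ => (Real.exp_pos _).le) a2.1
  have f3 := fub s hs (fun y => Real.exp (-c₀ * y)) (fun y => y + x) (by fun_prop) (by fun_prop)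
    (fun _ => (Real.exp_pos _).le) a3.1
  rw [a2.2] at f2
  rw [a3.2] at f3
  simp only [one_mul] at f1
  rw [a1.2] at f1
  simp only [neg_zero, zero_mul, Real.exp_zero, one_mul, zero_add] at f2
  have hF : ∀ t ∈ Set.Ioi (0:ℝ), Real.exp (-s ^ 2 * t) * F c₀ t x
      = Real.exp (-s ^ 2 * t) * (∫ y in Set.Ioi (0:ℝ), g t (x - y))
        - Real.exp (-s ^ 2 * t) * (∫ y in Set.Ioi (0:ℝ), g t (y + x))
        + 2 * (Real.exp (-s ^ 2 * t) *
          ∫ y in Set.Ioi (0:ℝ), Real.exp (-c₀ * y) * g t (y + x)) := by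
    intro t ht
    have hsub : ∫ y in Set.Ioi (0:ℝ), (g t (x - y) - g t (x + y))
        = (∫ y in Set.Ioi (0:ℝ), g t (x - y)) - ∫ y in Set.Ioi (0:ℝ), g t (y + x) := by
      simp only [add_comm x]
      exact integral_sub ((g_int t ht).comp_sub_left x).integrableOn
        ((g_int t ht).comp_add_right x).integrableOn
    rw [F, hsub]
    ring
  rw [setIntegral_congr_fun measurableSet_Ioi hF,
    integral_add (Integrable.sub' f1.1 f2.1) (f3.1.const_mul 2), integral_sub f1.1 f2.1, integral_const_mul,
    f1.2, f2.2, f3.2, show -x * s = -s * x by ring]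
  have : 0 < c₀ + s := by linarith
  field_simp
  ring
end

section
/- For every t > 0 and c ≥ 0, ∫₀^∞ e^{−cx} · (e^{−x²/(4t)}/√(πt)) dx = Σ_{k=0}^∞ (−c√t)^k / Γ(k/2 + 1), i.e. the Laplace transform in x of the density ℓ(t,x) = e^{−x²/(4t)}/√(πt) of the inverse 1/2-stable subordinator equals the Mittag-Leffler function E_{1/2}(−c√t). -/
open MeasureTheory Real

lemma aux_moment (t : ℝ) (ht : 0 < t) (k : ℕ) :
    ∫ x in Set.Ioi (0 : ℝ), x ^ k * Real.exp (-x ^ 2 / (4 * t))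
      = (k.factorial : ℝ) * √π * √t ^ (k + 1) / Real.Gamma ((k : ℝ) / 2 + 1) := by
  have h := integral_rpow_mul_exp_neg_mul_rpow (p := 2) (q := (k : ℝ)) (b := 1 / (4 * t))
    (by norm_num) (by have : (0 : ℝ) ≤ k := Nat.cast_nonneg k
                      linarith) (by positivity)
  have e : ∫ x in Set.Ioi (0 : ℝ), x ^ k * Real.exp (-x ^ 2 / (4 * t))
      = ∫ x in Set.Ioi (0 : ℝ), x ^ (k : ℝ) * Real.exp (-(1 / (4 * t)) * x ^ (2 : ℝ)) := by
    congr 1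
    funext x
    rw [Real.rpow_natCast, Real.rpow_two]
    congr 2
    ring
  rw [e, h]
  have hd := Real.Gamma_mul_Gamma_add_half (((k : ℝ) + 1) / 2)
  have h1 : ((k : ℝ) + 1) / 2 + 1 / 2 = (k : ℝ) / 2 + 1 := by ring
  have h2 : 2 * (((k : ℝ) + 1) / 2) = (k : ℝ) + 1 := by ring
  have h3 : (1 : ℝ) - (k + 1) = -(k : ℝ) := by ring
  rw [h1, h2, h3, Real.Gamma_nat_eq_factorial, Real.rpow_neg (by norm_num),
    Real.rpow_natCast] at hd
  have hG : 0 < Real.Gamma ((k : ℝ) / 2 + 1) := Real.Gamma_pos_of_pos (by positivity)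
  have hb : (1 / (4 * t)) ^ (-((k : ℝ) + 1) / 2) = (2 * √t) ^ (k + 1) := by
    have : 1 / (4 * t) = (2 * √t) ^ (-2 : ℝ) := by
      rw [Real.rpow_neg (by positivity), Real.rpow_two, mul_pow, Real.sq_sqrt ht.le]
      norm_num
    rw [this, ← Real.rpow_mul (by positivity), ← Real.rpow_natCast]
    congr 1
    push_cast
    ring
  rw [hb, eq_div_iff hG.ne', mul_assoc, hd, mul_pow]
  field_simp
  ring

/-- the Laplace transform in space of the density
`ℓ(t,x) = e^{-x²/(4t)}/√(πt)` of the inverse 1/2-stable subordinator is the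
Mittag-Leffler function `E_{1/2}(-c√t) = Σ_k (-c√t)^k / Γ(k/2+1)`. -/
theorem stmt15 (t c : ℝ) (ht : 0 < t) (hc : 0 ≤ c) :
    ∫ x in Set.Ioi (0 : ℝ), Real.exp (-c * x) * (Real.exp (-x ^ 2 / (4 * t)) / Real.sqrt (Real.pi * t))
      = ∑' k : ℕ, (-c * Real.sqrt t) ^ k / Real.Gamma ((k : ℝ) / 2 + 1) := by
  have hexp : ∀ y : ℝ, HasSum (fun k : ℕ => y ^ k / (k.factorial : ℝ)) (Real.exp y) := by
    intro y
    rw [Real.exp_eq_exp_ℝ]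
    exact NormedSpace.expSeries_div_hasSum_exp y
  set G : ℝ → ℝ := fun x => Real.exp (-x ^ 2 / (4 * t)) / Real.sqrt (Real.pi * t) with hGdef
  have hGc : Continuous G := by
    simp only [hGdef]
    fun_prop
  have hG0 : ∀ x, 0 ≤ G x := fun x => by simp only [hGdef]; positivity
  have key := hasSum_integral_of_dominated_convergence
    (μ := volume.restrict (Set.Ioi (0 : ℝ)))
    (F := fun (k : ℕ) x => (-c * x) ^ k / (k.factorial : ℝ) * G x)
    (f := fun x => Real.exp (-c * x) * G x)
    (fun (k : ℕ) x => |c * x| ^ k / (k.factorial : ℝ) * G x)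
    (fun k => by
      apply Continuous.aestronglyMeasurable
      fun_prop)
    (fun k => Filter.Eventually.of_forall fun x => by
      rw [norm_mul, norm_div, norm_pow, Real.norm_of_nonneg (hG0 x), neg_mul, norm_neg,
        Real.norm_eq_abs, Real.norm_natCast])
    (Filter.Eventually.of_forall fun x => ((hexp _).mul_right _).summable)
    (by
      have : (fun x => ∑' k : ℕ, |c * x| ^ k / (k.factorial : ℝ) * G x)
          = fun x => Real.exp |c * x| * G x := by
        funext x
        exact ((hexp _).mul_right _).tsum_eq
      rw [this]
      apply Integrable.integrableOn
      have hi : Integrable (fun x : ℝ => (Real.exp (2 * t * c ^ 2) / √(π * t)) *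
          Real.exp (-(1 / (8 * t)) * x ^ 2)) :=
        (integrable_exp_neg_mul_sq (by positivity)).const_mul _
      refine hi.mono' (by apply Continuous.aestronglyMeasurable; fun_prop)
        (Filter.Eventually.of_forall fun x => ?_)
      rw [Real.norm_of_nonneg (mul_nonneg (Real.exp_nonneg _) (hG0 x))]
      simp only [hGdef]
      rw [← mul_div_assoc, div_mul_eq_mul_div, ← Real.exp_add, ← Real.exp_add]
      refine div_le_div_of_nonneg_right (Real.exp_le_exp.mpr ?_) (Real.sqrt_nonneg _)
      have h8 : |c * x| ≤ 2 * t * c ^ 2 + x ^ 2 / (8 * t) := by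
        have e : 2 * t * c ^ 2 + x ^ 2 / (8 * t) - |c * x| = (4 * t * c - |x|) ^ 2 / (8 * t) := by
          rw [abs_mul, abs_of_nonneg hc, ← sq_abs x]
          field_simp
          ring
        have : 0 ≤ (4 * t * c - |x|) ^ 2 / (8 * t) := by positivity
        linarith
      have e2 : -x ^ 2 / (4 * t) = -(x ^ 2 / (8 * t)) - x ^ 2 / (8 * t) := by
        field_simp
        ring
      have e3 : -(1 / (8 * t)) * x ^ 2 = -(x ^ 2 / (8 * t)) := by ring
      linarith)
    (Filter.Eventually.of_forall fun x => (hexp _).mul_right _)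
  rw [← key.tsum_eq]
  congr 1
  funext k
  have : ∀ x : ℝ, (-c * x) ^ k / (k.factorial : ℝ) * G x
      = ((-c) ^ k / (k.factorial : ℝ) / √(π * t)) * (x ^ k * Real.exp (-x ^ 2 / (4 * t))) := by
    intro x
    simp only [hGdef]
    rw [mul_pow]
    ring
  simp_rw [this]
  rw [integral_const_mul, aux_moment t ht k, Real.sqrt_mul pi_pos.le, mul_pow]
  have h1 : √π ≠ 0 := by positivity
  have h2 : √t ≠ 0 := by positivity
  have h3 : (k.factorial : ℝ) ≠ 0 := by positivity
  have hG : Real.Gamma ((k : ℝ) / 2 + 1) ≠ 0 := (Real.Gamma_pos_of_pos (by positivity)).ne'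
  generalize Real.Gamma ((k : ℝ) / 2 + 1) = g at *
  field_simp
  ring
end

section
/- Let c₀ ≥ 0 and define r(t) = Σ_{k=0}^∞ (−c₀√t)^k / Γ(k/2 + 1) for t ≥ 0 (the Mittag-Leffler function E_{1/2}(−c₀√t)). Then for every t > 0 the Caputo fractional derivative of order 1/2 of r satisfies (1/√π) ∫₀^t r′(s)/√(t−s) ds = −c₀ · r(t), where r′ denotes the derivative of r. -/
open MeasureTheory Real

/-- The Mittag-Leffler function of order `1/2` evaluated at `-c√t`:
`r(t) = E_{1/2}(-c√t) = Σ_k (-c√t)^k / Γ(k/2+1)`. -/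
noncomputable def mlHalf (c t : ℝ) : ℝ :=
  ∑' k : ℕ, (-c * Real.sqrt t) ^ k / Real.Gamma ((k : ℝ) / 2 + 1)

lemma ml_gamma_pos (k : ℕ) : 0 < Real.Gamma ((k : ℝ) / 2 + 1) :=
  Real.Gamma_pos_of_pos (by positivity)

lemma ml_gamma_odd (m : ℕ) : (m.factorial : ℝ) * Real.Gamma (3 / 2) ≤ Real.Gamma ((m : ℝ) + 3 / 2) := by
  induction m with
  | zero => simp
  | succ n ih =>
    have h : ((n + 1 : ℕ) : ℝ) + 3 / 2 = ((n : ℝ) + 3 / 2) + 1 := by push_cast; ring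
    rw [h, Real.Gamma_add_one (by positivity), Nat.factorial_succ]
    push_cast
    have h0 : 0 < Real.Gamma (3 / 2) := Real.Gamma_pos_of_pos (by norm_num)
    have : ((n : ℝ) + 1) * (n.factorial * Real.Gamma (3 / 2))
        ≤ ((n : ℝ) + 3 / 2) * Real.Gamma ((n : ℝ) + 3 / 2) := by
      gcongr
      norm_num
    linarith

lemma ml_summable_nonneg (x : ℝ) (hx : 0 ≤ x) :
    Summable fun k : ℕ => x ^ k / Real.Gamma ((k : ℝ) / 2 + 1) := by
  have hgen : ∀ f : ℕ → ℝ, (Summable fun m : ℕ => f (2 * m)) →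
      (Summable fun m : ℕ => f (2 * m + 1)) → Summable f := fun f h1 h2 =>
    (h1.hasSum.even_add_odd h2.hasSum).summable
  apply hgen
  · have heq : ∀ m : ℕ, (x ^ 2) ^ m / (m.factorial : ℝ)
        = x ^ (2 * m) / Real.Gamma (((2 * m : ℕ) : ℝ) / 2 + 1) := by
      intro m
      have : ((2 * m : ℕ) : ℝ) / 2 + 1 = (m : ℝ) + 1 := by push_cast; ring
      rw [this, Real.Gamma_nat_eq_factorial, pow_mul]
    exact (Real.summable_pow_div_factorial (x ^ 2)).congr heq
  · refine Summable.of_nonneg_of_le (fun m => ?_) (fun m => ?_)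
      ((Real.summable_pow_div_factorial (x ^ 2)).mul_left (x / Real.Gamma (3 / 2)))
    · have := ml_gamma_pos (2 * m + 1)
      positivity
    · have : ((2 * m + 1 : ℕ) : ℝ) / 2 + 1 = (m : ℝ) + 3 / 2 := by push_cast; ring
      simp only [this]
      have h0 : 0 < Real.Gamma (3 / 2) := Real.Gamma_pos_of_pos (by norm_num)
      have h1 := ml_gamma_odd m
      calc x ^ (2 * m + 1) / Real.Gamma ((m : ℝ) + 3 / 2)
          ≤ x ^ (2 * m + 1) / ((m.factorial : ℝ) * Real.Gamma (3 / 2)) := by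
            gcongr
        _ = _ := by
            rw [pow_succ, pow_mul]; field_simp

lemma ml_hasDeriv (c y : ℝ) :
    HasDerivAt (fun z : ℝ => ∑' k : ℕ, (-c * z) ^ k / Real.Gamma ((k : ℝ) / 2 + 1))
      (∑' k : ℕ, (k : ℝ) * (-c * y) ^ (k - 1) * (-c) / Real.Gamma ((k : ℝ) / 2 + 1)) y := by
  have hR : 0 ≤ |c| * (|y| + 1) + |c| + 1 := by positivity
  set R := |c| * (|y| + 1) + |c| + 1 with hRd
  refine hasDerivAt_tsum_of_isPreconnected (t := Metric.ball (0 : ℝ) (|y| + 1))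
    (u := fun k : ℕ => (2 * R) ^ k / Real.Gamma ((k : ℝ) / 2 + 1)) (y₀ := 0)
    (g := fun (k : ℕ) (z : ℝ) => (-c * z) ^ k / Real.Gamma ((k : ℝ) / 2 + 1))
    (g' := fun (k : ℕ) (z : ℝ) =>
      (k : ℝ) * (-c * z) ^ (k - 1) * (-c) / Real.Gamma ((k : ℝ) / 2 + 1))
    (ml_summable_nonneg _ (by positivity)) Metric.isOpen_ball
    (convex_ball _ _).isPreconnected ?_ ?_ ?_ ?_ ?_
  · intro k z _
    have h1 : HasDerivAt (fun z : ℝ => -c * z) (-c) z := by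
      simpa using (hasDerivAt_id z).const_mul (-c)
    exact (h1.pow k).div_const _
  · intro k z hz
    have hz' : |z| ≤ |y| + 1 := by
      have := mem_ball_zero_iff.mp hz
      exact this.le
    rw [norm_div, norm_mul, norm_mul, norm_pow, norm_mul, norm_neg, Real.norm_eq_abs,
      Real.norm_eq_abs, Real.norm_eq_abs, Real.norm_eq_abs, abs_of_pos (ml_gamma_pos k),
      Nat.abs_cast]
    have hg := ml_gamma_pos k
    gcongr
    rcases k with _ | k
    · simp
    · have h1 : |c| * |z| ≤ R := by
        have : |c| * |z| ≤ |c| * (|y| + 1) := by gcongr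
        have := abs_nonneg c
        linarith
      have h2 : |c| ≤ R := by
        have : 0 ≤ |c| * (|y| + 1) := by positivity
        linarith
      have h3 : ((k + 1 : ℕ) : ℝ) ≤ 2 ^ (k + 1) := by
        exact_mod_cast (Nat.lt_two_pow_self (n := k + 1)).le
      rw [mul_pow 2 R, pow_succ R k, ← mul_assoc]
      simp only [Nat.add_sub_cancel]
      gcongr
  · simp; positivity
  · refine summable_of_ne_finset_zero (s := {0}) ?_
    intro k hk
    have : k ≠ 0 := by simpa using hk
    simp [this]
  · simp

lemma ml_deriv (c s : ℝ) (hs : 0 < s) :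
    deriv (mlHalf c) s
      = ∑' k : ℕ, (-c) ^ (k + 1) / Real.Gamma (((k : ℝ) + 1) / 2) * (√s ^ k / √s) := by
  have h := (ml_hasDeriv c (√s)).comp s (Real.hasDerivAt_sqrt hs.ne')
  have hs' : 0 < √s := Real.sqrt_pos.mpr hs
  have h2 : deriv (mlHalf c) s = _ := HasDerivAt.deriv h
  rw [h2]
  have hz : ∀ f : ℕ → ℝ, f 0 = 0 → ∑' k, f k = ∑' k, f (k + 1) := by
    intro f hf
    by_cases hsum : Summable f
    · rw [hsum.tsum_eq_zero_add, hf, zero_add]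
    · rw [tsum_eq_zero_of_not_summable hsum, tsum_eq_zero_of_not_summable]
      rwa [summable_nat_add_iff 1]
  rw [hz _ (by simp), ← tsum_mul_right]
  congr 1
  ext k
  have hg : Real.Gamma (((k + 1 : ℕ) : ℝ) / 2 + 1)
      = ((k : ℝ) + 1) / 2 * Real.Gamma (((k : ℝ) + 1) / 2) := by
    push_cast
    exact Real.Gamma_add_one (by positivity)
  have hg0 : 0 < Real.Gamma (((k : ℝ) + 1) / 2) := Real.Gamma_pos_of_pos (by positivity)
  rw [hg]
  simp only [Nat.add_sub_cancel]
  push_cast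
  rw [mul_pow, pow_succ (-c) k]
  field_simp

lemma ml_beta (t : ℝ) (ht : 0 < t) (k : ℕ) :
    ∫ s in (0 : ℝ)..t, √s ^ k / √s / √(t - s)
      = √t ^ k * (Real.Gamma (((k : ℝ) + 1) / 2) * √π / Real.Gamma ((k : ℝ) / 2 + 1)) := by
  have hb := Complex.betaIntegral_scaled ((((k : ℝ) + 1) / 2 : ℝ) : ℂ) ((1 / 2 : ℝ) : ℂ) ht
  have hB := ProbabilityTheory.beta_eq_betaIntegralReal (((k : ℝ) + 1) / 2) (1 / 2)
    (by positivity) (by norm_num)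
  have hsum : ((k : ℝ) + 1) / 2 + 1 / 2 = (k : ℝ) / 2 + 1 := by ring
  rw [ProbabilityTheory.beta, hsum, Real.Gamma_one_half_eq] at hB
  rw [hB]
  have hp : ∀ x : ℝ, 0 < x → √x ^ k = x ^ ((k : ℝ) / 2) := by
    intro x hx
    rw [Real.sqrt_eq_rpow, ← Real.rpow_natCast, ← Real.rpow_mul hx.le]
    congr 1; ring
  have hi : ∫ x in (0 : ℝ)..t, (x : ℂ) ^ (((((k : ℝ) + 1) / 2 : ℝ) : ℂ) - 1)
        * ((t : ℂ) - x) ^ (((1 / 2 : ℝ) : ℂ) - 1)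
      = ∫ x in (0 : ℝ)..t, ((√x ^ k / √x / √(t - x) : ℝ) : ℂ) := by
    rw [intervalIntegral.integral_of_le ht.le, intervalIntegral.integral_of_le ht.le]
    refine setIntegral_congr_fun measurableSet_Ioc ?_
    intro x hx
    have hx0 : 0 < x := hx.1
    have hx1 : 0 ≤ t - x := sub_nonneg.mpr hx.2
    have e1 : (((((k : ℝ) + 1) / 2 : ℝ) : ℂ) - 1) = ((((k : ℝ) / 2 - 1 / 2 : ℝ)) : ℂ) := by
      push_cast; ring
    have e2 : (((1 / 2 : ℝ) : ℂ) - 1) = ((-(1 / 2) : ℝ) : ℂ) := by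
      push_cast; ring
    simp only []
    rw [e1, e2, ← Complex.ofReal_sub, ← Complex.ofReal_cpow hx0.le, ← Complex.ofReal_cpow hx1,
      ← Complex.ofReal_mul, hp x hx0, Real.rpow_sub hx0, Real.rpow_neg hx1,
      ← Real.sqrt_eq_rpow, ← Real.sqrt_eq_rpow, div_eq_mul_inv _ (√(t - x))]
  rw [hi, intervalIntegral.integral_ofReal] at hb
  have e3 : ((((k : ℝ) + 1) / 2 : ℝ) : ℂ) + ((1 / 2 : ℝ) : ℂ) - 1 = (((k : ℝ) / 2 : ℝ) : ℂ) := by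
    push_cast; ring
  rw [e3, ← Complex.ofReal_cpow ht.le, ← hp t ht] at hb
  have := congrArg Complex.re hb
  rw [Complex.re_ofReal_mul, Complex.ofReal_re] at this
  exact this

/-- the Mittag-Leffler function `r(t) = E_{1/2}(-c₀√t)` is an
eigenfunction of the Caputo derivative of order `1/2`:
`(1/√π) ∫₀^t r'(s)/√(t-s) ds = -c₀ r(t)`. -/
theorem stmt16 (c₀ : ℝ) (hc : 0 ≤ c₀) (t : ℝ) (ht : 0 < t) :
    (1 / Real.sqrt Real.pi) * ∫ s in (0 : ℝ)..t, deriv (mlHalf c₀) s / Real.sqrt (t - s)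
      = -c₀ * mlHalf c₀ t := by
  have hpi : 0 < √π := Real.sqrt_pos.mpr Real.pi_pos
  have hst : 0 < √t := Real.sqrt_pos.mpr ht
  have hg0 : ∀ k : ℕ, 0 < Real.Gamma (((k : ℝ) + 1) / 2) := fun k =>
    Real.Gamma_pos_of_pos (by positivity)
  have hbeta := ml_beta t ht
  simp only [intervalIntegral.integral_of_le ht.le] at hbeta
  set F : ℕ → ℝ → ℝ := fun k s =>
    (-c₀) ^ (k + 1) / Real.Gamma (((k : ℝ) + 1) / 2) * (√s ^ k / √s / √(t - s)) with hF
  have hint : ∀ k, Integrable (F k) (volume.restrict (Set.Ioc 0 t)) := by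
    intro k
    refine Integrable.const_mul ?_ _
    refine Integrable.of_integral_ne_zero ?_
    rw [hbeta]
    have := hg0 k
    have := ml_gamma_pos k
    positivity
  have hnorm : ∀ k, ∫ s in Set.Ioc 0 t, ‖F k s‖
      = c₀ * √π * ((c₀ * √t) ^ k / Real.Gamma ((k : ℝ) / 2 + 1)) := by
    intro k
    have h1 : ∀ s, ‖F k s‖ =
        c₀ ^ (k + 1) / Real.Gamma (((k : ℝ) + 1) / 2) * (√s ^ k / √s / √(t - s)) := by
      intro s
      rw [hF]
      simp only []
      rw [norm_mul, norm_div, norm_pow, norm_neg, Real.norm_of_nonneg hc,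
        Real.norm_of_nonneg (hg0 k).le, Real.norm_of_nonneg (by positivity)]
    simp only [h1]
    rw [integral_const_mul, hbeta]
    have := hg0 k
    have := ml_gamma_pos k
    rw [mul_pow, pow_succ]
    field_simp
  have hval : ∀ k, ∫ s in Set.Ioc 0 t, F k s
      = -c₀ * √π * ((-c₀ * √t) ^ k / Real.Gamma ((k : ℝ) / 2 + 1)) := by
    intro k
    rw [hF]
    simp only []
    rw [integral_const_mul, hbeta]
    have := hg0 k
    have := ml_gamma_pos k
    rw [mul_pow, pow_succ]
    field_simp
  have hS : Summable fun k => ∫ s in Set.Ioc 0 t, ‖F k s‖ := by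
    simp only [hnorm]
    exact (ml_summable_nonneg _ (by positivity)).mul_left _
  have key := (hasSum_integral_of_summable_integral_norm hint hS).tsum_eq
  simp only [hval] at key
  rw [tsum_mul_left] at key
  have hd : ∫ s in (0 : ℝ)..t, deriv (mlHalf c₀) s / √(t - s)
      = ∫ s in Set.Ioc 0 t, ∑' k, F k s := by
    rw [intervalIntegral.integral_of_le ht.le]
    refine setIntegral_congr_fun measurableSet_Ioc ?_
    intro s hs
    simp only [hF]
    rw [ml_deriv c₀ s hs.1, ← tsum_div_const]
    congr 1
    ext k
    ring
  rw [hd, ← key, mlHalf]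
  field_simp
end

section
/- Let μ ∈ ℝ, c₀ ≥ 0 and set p(t,x,y) = m^μ(t,x,y) · p⁰(t,x,y). Then for every t > 0 and y > 0, the derivative in x at x = 0 satisfies ∂p/∂x (t, 0, y) = (c₀ − μ/2) · p(t, 0, y). -/
open MeasureTheory Real Filter

/-- The elastic Brownian kernel `p⁰(t,x,y)` with elastic coefficient `c₀`. -/
noncomputable def p0 (c₀ t x y : ℝ) : ℝ :=
  g t (x - y) - g t (x + y)
    + ∫ w in Set.Ioi (0 : ℝ), Real.exp (-c₀ * w) * ((w + x + y) / t) * g t (w + x + y)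

/-- The drift factor `m^μ(t,x,y) = exp(-μ²t/4 - (μ/2)(x-y))`. -/
noncomputable def mKer (μ t x y : ℝ) : ℝ := Real.exp (-μ ^ 2 * t / 4 - μ / 2 * (x - y))

/-- `u(t,x) = ∫₀^∞ m^μ(t,x,y) p⁰(t,x,y) dy`. -/
noncomputable def uFun (μ c₀ t x : ℝ) : ℝ :=
  ∫ y in Set.Ioi (0 : ℝ), mKer μ t x y * p0 c₀ t x y

/-- The tail `Π̄_η(z) = ∫_z^∞ e^{-ηs}/(2√π s^{3/2}) ds` of the tempered 1/2-stable
Lévy measure. -/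
noncomputable def PiBar (η z : ℝ) : ℝ :=
  ∫ s in Set.Ioi z, Real.exp (-η * s) / (2 * Real.sqrt Real.pi * s ^ ((3 : ℝ) / 2))


lemma g_hasDerivAt (t z : ℝ) (ht : 0 < t) : HasDerivAt (g t) (-(z / (2 * t)) * g t z) z := by
  have h1 : HasDerivAt (fun z : ℝ => -z ^ 2 / (4 * t)) (-(z / (2 * t))) z := by
    have := ((hasDerivAt_pow 2 z).neg).div_const (4 * t)
    refine this.congr_deriv ?_
    field_simp
    norm_num
    ring
  have := h1.exp.div_const (Real.sqrt (4 * Real.pi * t))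
  refine this.congr_deriv ?_
  unfold g
  ring

lemma g_cont (t : ℝ) : Continuous (g t) := by
  unfold g
  fun_prop

lemma F_cont (c t y : ℝ) :
    Continuous (fun v : ℝ => Real.exp (-c * v) * ((v + y) / t * g t (v + y))) := by
  have := g_cont t
  fun_prop

lemma F_int (c t y a : ℝ) (hc : 0 ≤ c) (ht : 0 < t) :
    IntegrableOn (fun v : ℝ => Real.exp (-c * v) * ((v + y) / t * g t (v + y))) (Set.Ioi a) := by
  have h0 : Integrable (fun z : ℝ => z / t * g t z) := by
    have hb : 0 < 1 / (4 * t) := by positivity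
    have := (integrable_mul_exp_neg_mul_sq hb).const_mul (1 / t / Real.sqrt (4 * Real.pi * t))
    refine this.congr (Eventually.of_forall fun z => ?_)
    have e : -(1 / (4 * t)) * z ^ 2 = -z ^ 2 / (4 * t) := by ring
    simp only [g, e]
    ring
  have h1 : Integrable (fun v : ℝ => (v + y) / t * g t (v + y)) := h0.comp_add_right y
  refine Integrable.bdd_mul (c := Real.exp (-c * a)) h1.integrableOn ?_ ?_
  · exact Continuous.aestronglyMeasurable (by fun_prop)
  · refine (ae_restrict_iff' measurableSet_Ioi).2 (Eventually.of_forall fun v hv => ?_)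
    have hv' : a < v := hv
    rw [Real.norm_eq_abs, abs_of_pos (Real.exp_pos _)]
    apply Real.exp_le_exp.2
    nlinarith

lemma I_eq (c t y x : ℝ) (hc : 0 ≤ c) (ht : 0 < t) :
    ∫ w in Set.Ioi (0 : ℝ), Real.exp (-c * w) * ((w + x + y) / t) * g t (w + x + y)
      = Real.exp (c * x) *
        ((∫ v in Set.Ioi (0 : ℝ), Real.exp (-c * v) * ((v + y) / t * g t (v + y)))
          - ∫ v in (0 : ℝ)..x, Real.exp (-c * v) * ((v + y) / t * g t (v + y))) := by
  rw [← intervalIntegral.integral_interval_add_Ioi (F_int c t y 0 hc ht) (F_int c t y x hc ht),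
    add_sub_cancel_left,
    ← (measurePreserving_add_right volume x).setIntegral_preimage_emb
      (measurableEmbedding_addRight x) _ (Set.Ioi x), ← integral_const_mul]
  have : (fun v : ℝ => v + x) ⁻¹' Set.Ioi x = Set.Ioi 0 := by
    ext v; simp
  rw [this]
  congr 1
  ext w
  have e : Real.exp (-c * w) = Real.exp (c * x) * Real.exp (-c * (w + x)) := by
    rw [← Real.exp_add]; congr 1; ring
  rw [e]; ring

lemma p0_hasDerivAt (c t y : ℝ) (hc : 0 ≤ c) (ht : 0 < t) :
    HasDerivAt (fun x => p0 c t x y) (c * p0 c t 0 y) 0 := by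
  have hF := ((F_cont c t y).integral_hasStrictDerivAt 0 0).hasDerivAt
  have he : HasDerivAt (fun x : ℝ => Real.exp (c * x)) (Real.exp (c * 0) * (c * 1)) 0 :=
    ((hasDerivAt_id (0 : ℝ)).const_mul c).exp
  have hI := he.mul (hF.const_sub
    (∫ v in Set.Ioi (0 : ℝ), Real.exp (-c * v) * ((v + y) / t * g t (v + y))))
  have h1 : HasDerivAt (fun x : ℝ => g t (x - y)) _ 0 :=
    (g_hasDerivAt t (0 - y) ht).comp_sub_const 0 y
  have h2 : HasDerivAt (fun x : ℝ => g t (x + y)) _ 0 :=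
    (g_hasDerivAt t (0 + y) ht).comp_add_const 0 y
  have h := (h1.sub h2).add hI
  have hfun : (fun x => p0 c t x y) = fun x => g t (x - y) - g t (x + y) + Real.exp (c * x) *
        ((∫ v in Set.Ioi (0 : ℝ), Real.exp (-c * v) * ((v + y) / t * g t (v + y)))
          - ∫ v in (0 : ℝ)..x, Real.exp (-c * v) * ((v + y) / t * g t (v + y))) := by
    funext x
    rw [p0, I_eq c t y x hc ht]
  have hg : g t (-y) = g t y := by simp [g]
  have h0 := congrFun hfun 0
  rw [h0, hfun]
  refine h.congr_deriv ?_
  simp only [zero_sub, zero_add, hg, mul_zero, Real.exp_zero, intervalIntegral.integral_same]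
  field_simp
  ring

/-- the transition density `p(t,x,y) = m^μ(t,x,y) p⁰(t,x,y)` of the
elastic drifted Brownian motion satisfies the Robin boundary condition at `x = 0`:
`∂p/∂x(t,0,y) = (c₀ - μ/2) p(t,0,y)`. -/
theorem stmt18 (μ c₀ : ℝ) (hc : 0 ≤ c₀) (t y : ℝ) (ht : 0 < t) (hy : 0 < y) :
    deriv (fun x => mKer μ t x y * p0 c₀ t x y) 0
      = (c₀ - μ / 2) * (mKer μ t 0 y * p0 c₀ t 0 y) := by
  have hm : HasDerivAt (fun x => mKer μ t x y) (mKer μ t 0 y * (-(μ / 2))) 0 := by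
    have h1 : HasDerivAt (fun x : ℝ => -μ ^ 2 * t / 4 - μ / 2 * (x - y)) (-(μ / 2 * 1)) 0 :=
      (((hasDerivAt_id (0 : ℝ)).sub_const y).const_mul (μ / 2)).const_sub _
    rw [mul_one] at h1
    exact h1.exp
  have := (hm.mul (p0_hasDerivAt c₀ t y hc ht)).deriv
  refine Eq.trans this ?_
  ring
end
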